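/- For every integer q and every real s with 1 < s ≤ q, let α be a solution to OPT_q(s), let A_1, …, A_k be distinct sets in the support of α, and let M be the k×k symmetric 0/1 matrix with M_{ij} = 1 if and only if i ≠ j and A_i ∩ A_j = ∅ (the adjacency matrix of the subgraph of SUPP_q(α) induced by A_1,…,A_k). Then M has at most two positive eigenvalues (counted with multiplicity). Moreover, if M has at least three nonnegative eigenvalues (counted with multiplicity), then there exists another solution α' to OPT_q(s) whose support is a proper subset of the support of α, such that α' agrees with α on every coordinate indexed by a set not among A_1,…,A_k, and the line segment joining α and α' is entirely contained in FEAS_q(s). -/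

import Mathlib

/-- The nonempty subsets of `[q] = Fin q`, indexing the coordinates of our vectors. -/
def NEsets (q : ℕ) : Finset (Finset (Fin q)) :=
  Finset.univ.filter (fun A => A.Nonempty)

/-- The objective function `OBJ_q(α) = Σ_{A ≠ ∅} α_A log |A|`. -/
noncomputable def objQ (q : ℕ) (α : Finset (Fin q) → ℝ) : ℝ :=
  ∑ A ∈ NEsets q, α A * Real.log (A.card : ℝ)

/-- The constraint function `V_q(α) = Σ_{A ≠ ∅} α_A`. -/
noncomputable def vQ (q : ℕ) (α : Finset (Fin q) → ℝ) : ℝ :=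
  ∑ A ∈ NEsets q, α A

/-- The constraint function `E_q(α) = Σ_{{A,B} : A ∩ B = ∅} α_A α_B`, the sum being
over unordered pairs of disjoint nonempty sets. -/
noncomputable def eQ (q : ℕ) (α : Finset (Fin q) → ℝ) : ℝ :=
  (1 / 2) * ∑ A ∈ NEsets q, ∑ B ∈ NEsets q,
    if Disjoint A B then α A * α B else 0

/-- The feasible set `FEAS_q(s)`: nonnegative vectors (indexed by nonempty subsets of
`[q]`, so the coordinate at `∅` is normalized to `0`) with `V_q(α) = 1` and
`E_q(α) ≥ (s-1)/(2s)`. -/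
def Feas (q : ℕ) (s : ℝ) (α : Finset (Fin q) → ℝ) : Prop :=
  α ∅ = 0 ∧ (∀ A, 0 ≤ α A) ∧ vQ q α = 1 ∧ (s - 1) / (2 * s) ≤ eQ q α

/-- `α` is a solution to `OPT_q(s)`: it is feasible and maximizes `OBJ_q` over
`FEAS_q(s)`. -/
def IsSolution (q : ℕ) (s : ℝ) (α : Finset (Fin q) → ℝ) : Prop :=
  Feas q s α ∧ ∀ β, Feas q s β → objQ q β ≤ objQ q α

/-- The support of `α`: the nonempty sets `A ⊆ [q]` with `α_A > 0`. -/
noncomputable def supp (q : ℕ) (α : Finset (Fin q) → ℝ) : Finset (Finset (Fin q)) :=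
  @Finset.filter _ (fun A => 0 < α A) (Classical.decPred _) (NEsets q)

/-- `P` is a partition of `[q]` into nonempty parts. -/
def IsPartitionOf (q : ℕ) (P : Finset (Finset (Fin q))) : Prop :=
  (∀ A ∈ P, A.Nonempty) ∧ (∀ A ∈ P, ∀ B ∈ P, A ≠ B → Disjoint A B) ∧
    P.biUnion id = Finset.univ

/-- `SUPP_q(α)` is in class `P_k`: the support of `α` is a partition of `[q]`
into `k` nonempty sets. -/
def ClassP (q k : ℕ) (α : Finset (Fin q) → ℝ) : Prop :=
  IsPartitionOf q (supp q α) ∧ (supp q α).card = k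

/-- `SUPP_q(α)` is in class `Q_k`: the support of `α` consists of a partition
`A₁, …, A_k` of `[q]` into `k` nonempty sets together with the set `A₁ ∪ A₂`. -/
def ClassQ (q k : ℕ) (α : Finset (Fin q) → ℝ) : Prop :=
  ∃ P : Finset (Finset (Fin q)), ∃ A₁ ∈ P, ∃ A₂ ∈ P, A₁ ≠ A₂ ∧
    IsPartitionOf q P ∧ P.card = k ∧ supp q α = insert (A₁ ∪ A₂) P

open Finset Matrix

lemma mem_NEsets {q : ℕ} {B : Finset (Fin q)} : B ∈ NEsets q ↔ B.Nonempty := by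
  simp [NEsets]

lemma mem_supp {q : ℕ} {α : Finset (Fin q) → ℝ} {B : Finset (Fin q)} :
    B ∈ supp q α ↔ B.Nonempty ∧ 0 < α B := by
  simp [supp, mem_NEsets]

lemma vQ_add_mul (q : ℕ) (α x : Finset (Fin q) → ℝ) (t : ℝ) :
    vQ q (fun B => α B + t * x B) = vQ q α + t * vQ q x := by
  simp only [vQ, sum_add_distrib, mul_sum]

lemma objQ_add_mul (q : ℕ) (α x : Finset (Fin q) → ℝ) (t : ℝ) :
    objQ q (fun B => α B + t * x B) = objQ q α + t * objQ q x := by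
  simp only [objQ, add_mul, sum_add_distrib, mul_sum, mul_assoc]

/-- Along a line, `eQ` is a quadratic polynomial whose leading coefficient is the value of `eQ`
at the direction. -/
lemma exists_eQ_add_mul (q : ℕ) (α x : Finset (Fin q) → ℝ) :
    ∃ b : ℝ, ∀ t : ℝ, eQ q (fun B => α B + t * x B) = eQ q α + t * b + t ^ 2 * eQ q x := by
  refine ⟨(1 / 2) * ∑ A ∈ NEsets q, ∑ B ∈ NEsets q,
    if Disjoint A B then α A * x B + x A * α B else 0, fun t => ?_⟩
  simp only [eQ, mul_sum, ← sum_add_distrib]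
  refine sum_congr rfl fun A _ => sum_congr rfl fun B _ => ?_
  split_ifs <;> ring

/-- A nonzero vector with zero sum can be added to a vector that is positive on its support until
a coordinate vanishes, with all coordinates staying nonnegative. -/
lemma exists_maximal_step {q : ℕ} {α x : Finset (Fin q) → ℝ} (hα : ∀ B, 0 ≤ α B)
    (hx : ∀ B, x B ≠ 0 → B ∈ supp q α) (hx0 : x ≠ 0) (hv : vQ q x = 0) :
    ∃ τ : ℝ, 0 < τ ∧ (∀ B, 0 ≤ α B + τ * x B) ∧ ∃ B ∈ supp q α, α B + τ * x B = 0 := by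
  have hneg : ∃ B, x B < 0 := by
    by_contra! h
    refine hx0 (funext fun B => ?_)
    by_contra hB
    exact hB ((sum_eq_zero_iff_of_nonneg fun B _ => h B).1 hv B
      (mem_NEsets.2 (mem_supp.1 (hx B hB)).1))
  obtain ⟨B₀, hB₀, hmin⟩ := exists_min_image (univ.filter fun B => x B < 0)
    (fun B => α B / -x B) (by simpa [Finset.Nonempty] using hneg)
  have hB₀' : x B₀ < 0 := by simpa using hB₀
  have hs := hx B₀ hB₀'.ne
  have hpos : 0 < α B₀ / -x B₀ := div_pos (mem_supp.1 hs).2 (neg_pos.2 hB₀')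
  refine ⟨α B₀ / -x B₀, hpos, fun B => ?_, B₀, hs, ?_⟩
  · rcases lt_or_ge (x B) 0 with h | h
    · have := (le_div_iff₀ (neg_pos.2 h)).1 (hmin B (by simpa using h))
      linarith
    · exact add_nonneg (hα B) (mul_nonneg hpos.le h)
  · have := hB₀'.ne
    field_simp
    ring

/-- A solution may be moved along a direction on which both linear functionals vanish and `eQ` is
nonnegative, to a solution of smaller support. -/
lemma IsSolution.exists_shift {q : ℕ} {s : ℝ} {α : Finset (Fin q) → ℝ} (hα : IsSolution q s α)
    {x : Finset (Fin q) → ℝ} (hx : ∀ B, x B ≠ 0 → B ∈ supp q α) (hx0 : x ≠ 0)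
    (hv : vQ q x = 0) (ho : objQ q x = 0) (he : 0 ≤ eQ q x) :
    ∃ α' : Finset (Fin q) → ℝ, IsSolution q s α' ∧ supp q α' ⊂ supp q α ∧
      (∀ B, x B = 0 → α' B = α B) ∧
      (∀ t : ℝ, t ∈ Set.Icc (0 : ℝ) 1 → Feas q s (fun B => (1 - t) * α B + t * α' B)) ∧
      (0 < eQ q x → eQ q α < eQ q α') := by
  obtain ⟨b, hb⟩ := exists_eQ_add_mul q α x
  wlog hb0 : 0 ≤ b generalizing x b with H
  · have heq (t : ℝ) : (fun B => t * (-x) B) = fun B => -t * x B := by ext; simp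
    have hx' : eQ q (-x) = eQ q x := by simp [eQ]
    have := H (x := -x) (by simpa using hx) (by simpa using hx0)
      (by simpa [vQ] using hv) (by simpa [objQ] using ho) (by rwa [hx']) (-b)
      (fun t => by
        have := hb (-t)
        simp only [Pi.neg_apply, mul_neg, hx', neg_mul, neg_sq] at this ⊢
        exact this) (by linarith)
    simpa [hx'] using this
  obtain ⟨⟨hα0, hαn, hαv, hαe⟩, hmax⟩ := hα
  obtain ⟨τ, hτ, hτn, B₀, hB₀, hτB₀⟩ := exists_maximal_step hαn hx hx0 hv
  have hseg (t : ℝ) (ht : t ∈ Set.Icc (0 : ℝ) 1) :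
      Feas q s (fun B => (1 - t) * α B + t * (α B + τ * x B)) := by
    have heq : (fun B => (1 - t) * α B + t * (α B + τ * x B)) =
        fun B => α B + (t * τ) * x B := by ext; ring
    have hx_empty : x ∅ = 0 := by
      by_contra h
      simpa using (mem_supp.1 (hx ∅ h)).1
    refine ⟨by simp [hα0, hx_empty], fun B => ?_, ?_, ?_⟩
    · exact add_nonneg (mul_nonneg (sub_nonneg.2 ht.2) (hαn B)) (mul_nonneg ht.1 (hτn B))
    · rw [heq, vQ_add_mul, hv, hαv]; simp
    · rw [heq, hb]
      have := mul_nonneg (mul_nonneg ht.1 hτ.le) hb0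
      have := mul_nonneg (sq_nonneg (t * τ)) he
      linarith
  refine ⟨fun B => α B + τ * x B, ⟨by simpa using hseg 1 (by simp), fun β hβ => ?_⟩, ?_,
    fun B hB => by simp [hB], hseg, fun h => ?_⟩
  · rw [objQ_add_mul, ho]
    simpa using hmax β hβ
  · refine (ssubset_iff_of_subset fun B hB => ?_).2 ⟨B₀, hB₀, by simp [mem_supp, hτB₀]⟩
    by_cases h : x B = 0
    · simpa [mem_supp, h] using hB
    · exact hx B h
  · rw [hb]
    have := mul_nonneg hτ.le hb0
    have := mul_pos (pow_pos hτ 2) h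
    linarith

lemma eQ_mono {q : ℕ} {α β : Finset (Fin q) → ℝ} (hα : ∀ B, 0 ≤ α B) (h : ∀ B, α B ≤ β B) :
    eQ q α ≤ eQ q β := by
  unfold eQ
  gcongr with A _ B _
  split_ifs
  · exact mul_le_mul (h A) (h B) (hα B) ((hα A).trans (h A))
  · rfl

lemma eQ_mul (q : ℕ) (α : Finset (Fin q) → ℝ) (c : ℝ) :
    eQ q (fun B => c * α B) = c ^ 2 * eQ q α := by
  simp only [eQ, mul_sum]
  refine sum_congr rfl fun A _ => sum_congr rfl fun B _ => ?_
  split_ifs <;> ring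

/-- The maximal conceivable objective value `log q` is not attained by vectors with `eQ > 0`. -/
lemma objQ_lt_log {q : ℕ} {α : Finset (Fin q) → ℝ} (hα : ∀ B, 0 ≤ α B) (hv : vQ q α = 1)
    (he : 0 < eQ q α) : objQ q α < Real.log q := by
  have hle (B : Finset (Fin q)) (hB : B ∈ NEsets q) : Real.log B.card ≤ Real.log q := by
    refine Real.log_le_log (by exact_mod_cast (mem_NEsets.1 hB).card_pos) ?_
    simpa using card_le_univ B
  have hlog : Real.log q = ∑ B ∈ NEsets q, α B * Real.log q := by
    rw [← sum_mul, ← vQ, hv, one_mul]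
  rw [hlog]
  refine sum_lt_sum (fun B hB => mul_le_mul_of_nonneg_left (hle B hB) (hα B)) ?_
  by_contra! h
  have hzero (B : Finset (Fin q)) (hB : B ∈ NEsets q) (hne : B ≠ univ) : α B = 0 := by
    by_contra hαB
    refine (h B hB).not_gt (mul_lt_mul_of_pos_left ?_ ((hα B).lt_of_ne' hαB))
    refine Real.log_lt_log (by exact_mod_cast (mem_NEsets.1 hB).card_pos) ?_
    exact_mod_cast (by simpa using card_lt_univ_of_notMem (not_forall.1
      fun h => hne (eq_univ_iff_forall.2 h)).choose_spec : B.card < q)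
  refine he.ne' ?_
  unfold eQ
  rw [sum_eq_zero fun A hA => sum_eq_zero fun B hB => ?_, mul_zero]
  split_ifs with hd
  · by_cases hAu : A = univ
    · have : B ≠ univ := by
        rintro rfl
        exact (mem_NEsets.1 hA).ne_empty (disjoint_top.1 hd)
      rw [hzero B hB this, mul_zero]
    · rw [hzero A hA hAu, zero_mul]
  · rfl

/-- At a solution the quadratic constraint is tight. -/
lemma IsSolution.eQ_le {q : ℕ} {s : ℝ} (hs : 1 < s) (hsq : s ≤ q) {α : Finset (Fin q) → ℝ}
    (hα : IsSolution q s α) : eQ q α ≤ (s - 1) / (2 * s) := by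
  obtain ⟨⟨hα0, hαn, hαv, hαe⟩, hmax⟩ := hα
  by_contra! hlt
  have hc : 0 < (s - 1) / (2 * s) := div_pos (by linarith) (by linarith)
  have hE : 0 < eQ q α := hc.trans hlt
  have hlog := objQ_lt_log hαn hαv hE
  have hq : (univ : Finset (Fin q)).Nonempty := by
    rw [← card_pos, card_univ, Fintype.card_fin]
    exact_mod_cast (by linarith : (0 : ℝ) < q)
  set c := (s - 1) / (2 * s)
  set ε := (eQ q α - c) / (2 * eQ q α) with hε
  have hε0 : 0 < ε := div_pos (by linarith) (by linarith)
  have hε1 : ε ≤ 1 := by rw [hε, div_le_one (by linarith)]; linarith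
  have hεE : ε * eQ q α = (eQ q α - c) / 2 := by rw [hε]; field_simp
  have hsplit (f : Finset (Fin q) → ℝ) :
      ∑ B ∈ NEsets q, ((1 - ε) * α B + if B = univ then ε else 0) * f B =
        (1 - ε) * ∑ B ∈ NEsets q, α B * f B + ε * f univ := by
    simp [add_mul, sum_add_distrib, mul_sum, mul_assoc, ite_mul, mem_NEsets, hq]
  have hfeas : Feas q s fun B => (1 - ε) * α B + if B = univ then ε else 0 := by
    refine ⟨by simp [hα0, hq.ne_empty.symm], fun B => ?_, ?_, ?_⟩
    · exact add_nonneg (mul_nonneg (by linarith) (hαn B)) (by split_ifs <;> linarith)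
    · have := hsplit fun _ => 1
      simp only [mul_one] at this
      rw [vQ, this, ← vQ, hαv]
      ring
    · refine le_trans ?_ (eQ_mono (α := fun B => (1 - ε) * α B)
        (fun B => mul_nonneg (by linarith) (hαn B)) fun B => ?_)
      · rw [eQ_mul]
        nlinarith [mul_nonneg (sq_nonneg ε) hE.le]
      · have : 0 ≤ if B = univ then ε else 0 := by split_ifs <;> linarith
        linarith
  have h := hmax _ hfeas
  rw [objQ, hsplit fun B => Real.log B.card, ← objQ, card_univ, Fintype.card_fin] at h
  nlinarith

/-- Two linear conditions leave a nonzero vector in a span of at least three eigenvectors. -/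
lemma Matrix.IsHermitian.exists_ne_zero_dotProduct_mulVec_eq {n : Type*} [Fintype n]
    [DecidableEq n] {M : Matrix n n ℝ} (hM : M.IsHermitian) (l : (n → ℝ) →ₗ[ℝ] ℝ × ℝ)
    (S : Finset n) (hS : 3 ≤ S.card) :
    ∃ v : n → ℝ, v ≠ 0 ∧ l v = 0 ∧ ∃ w : n → ℝ, w ≠ 0 ∧ (∀ i ∉ S, w i = 0) ∧
      v ⬝ᵥ M *ᵥ v = ∑ i, hM.eigenvalues i * w i ^ 2 := by
  set U : Matrix n n ℝ := (hM.eigenvectorUnitary : Matrix n n ℝ)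
  have hspec : M = U * diagonal hM.eigenvalues * Uᵀ := by
    have := hM.spectral_theorem
    simpa [Unitary.conjStarAlgAut_apply, star_eq_conjTranspose] using this
  have hUU : U * Uᵀ = 1 := by
    have := Unitary.coe_mul_star_self hM.eigenvectorUnitary
    simpa [star_eq_conjTranspose] using this
  let L : (n → ℝ) →ₗ[ℝ] (ℝ × ℝ) × ((Sᶜ : Finset n) → ℝ) :=
    l.prod ((LinearMap.funLeft ℝ ℝ Subtype.val).comp Uᵀ.mulVecLin)
  have hker : LinearMap.ker L ≠ ⊥ := by
    refine LinearMap.ker_ne_bot_of_finrank_lt ?_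
    have := card_le_univ S
    simp
    omega
  obtain ⟨v, hv, hv0⟩ := Submodule.exists_mem_ne_zero_of_ne_bot hker
  obtain ⟨h1, h2⟩ : l v = 0 ∧ _ = _ := Prod.ext_iff.1 (LinearMap.mem_ker.1 hv)
  refine ⟨v, hv0, h1, Uᵀ *ᵥ v, fun h => hv0 ?_, fun i hi => congrFun h2 ⟨i, by simpa using hi⟩, ?_⟩
  · rw [← one_mulVec v, ← hUU, ← mulVec_mulVec, h, mulVec_zero]
  · have hMv : M *ᵥ v = U *ᵥ diagonal hM.eigenvalues *ᵥ Uᵀ *ᵥ v := by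
      rw [mulVec_mulVec, mulVec_mulVec, ← hspec]
    rw [hMv, dotProduct_mulVec, ← mulVec_transpose]
    simp only [dotProduct, mulVec_diagonal]
    exact sum_congr rfl fun i _ => by ring

lemma sum_extend_mul {q k : ℕ} {A : Fin k → Finset (Fin q)} (hinj : Function.Injective A)
    (hA : ∀ i, (A i).Nonempty) (v : Fin k → ℝ) (f : Finset (Fin q) → ℝ) :
    ∑ B ∈ NEsets q, Function.extend A v 0 B * f B = ∑ i, v i * f (A i) := by
  have himg : univ.image A ⊆ NEsets q := by
    simpa [Finset.subset_iff, mem_NEsets] using hA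
  rw [← sum_subset himg, sum_image hinj.injOn]
  · simp [hinj.extend_apply]
  · intro B _ hB
    rw [Function.extend_apply' _ _ _ (by simpa using hB)]
    simp

lemma eQ_extend {q k : ℕ} {A : Fin k → Finset (Fin q)} (hinj : Function.Injective A)
    (hA : ∀ i, (A i).Nonempty) (v : Fin k → ℝ) :
    eQ q (Function.extend A v 0) = (1 / 2) * (v ⬝ᵥ (Matrix.of fun i j =>
      if i ≠ j ∧ Disjoint (A i) (A j) then (1 : ℝ) else 0) *ᵥ v) := by
  have hrow (B : Finset (Fin q)) :
      (∑ C ∈ NEsets q, if Disjoint B C then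
        Function.extend A v 0 B * Function.extend A v 0 C else 0) =
      Function.extend A v 0 B * ∑ i, v i * if Disjoint B (A i) then 1 else 0 := by
    rw [← sum_extend_mul hinj hA v fun C => if Disjoint B C then 1 else 0, mul_sum]
    exact sum_congr rfl fun C _ => by split_ifs <;> ring
  simp only [eQ, hrow]
  rw [sum_extend_mul hinj hA v fun B => ∑ i, v i * if Disjoint B (A i) then 1 else 0]
  simp only [dotProduct, mulVec, of_apply]
  congr 1
  refine sum_congr rfl fun i _ => ?_
  congr 1
  refine sum_congr rfl fun j _ => ?_
  have : Disjoint (A i) (A j) → i ≠ j := by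
    rintro h rfl
    exact (hA i).ne_empty (by simpa using h)
  rw [mul_comm]
  congr 1
  exact if_congr ⟨fun h => ⟨this h, h⟩, And.right⟩ rfl rfl

/-- Let `α` solve `OPT_q(s)`, let `A_1, …, A_k` be distinct sets in the support of `α`,
and let `M` be the adjacency matrix of the subgraph of `SUPP_q(α)` they induce
(`M i j = 1` iff `i ≠ j` and `A i`, `A j` are disjoint). Then `M` has at most two
positive eigenvalues; and if it has at least three nonnegative eigenvalues, there is
another solution `α'` with strictly smaller support, agreeing with `α` outside the
coordinates `A_1, …, A_k`, such that the segment from `α` to `α'` lies in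
`FEAS_q(s)`. -/
theorem eigenvalue_structure (q : ℕ) (s : ℝ) (hs : 1 < s) (hsq : s ≤ q)
    (α : Finset (Fin q) → ℝ) (hα : IsSolution q s α)
    (k : ℕ) (A : Fin k → Finset (Fin q)) (hinj : Function.Injective A)
    (hmem : ∀ i, A i ∈ supp q α)
    (M : Matrix (Fin k) (Fin k) ℝ)
    (hMdef : M = Matrix.of fun i j =>
      if i ≠ j ∧ Disjoint (A i) (A j) then (1 : ℝ) else 0)
    (hherm : M.IsHermitian) :
    (Finset.univ.filter (fun i => 0 < hherm.eigenvalues i)).card ≤ 2 ∧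
    (3 ≤ (Finset.univ.filter (fun i => 0 ≤ hherm.eigenvalues i)).card →
      ∃ α' : Finset (Fin q) → ℝ, IsSolution q s α' ∧
        supp q α' ⊂ supp q α ∧
        (∀ B : Finset (Fin q), (∀ i, B ≠ A i) → α' B = α B) ∧
        ∀ t : ℝ, t ∈ Set.Icc (0 : ℝ) 1 →
          Feas q s (fun B => (1 - t) * α B + t * α' B)) := by
  have hA (i : Fin k) : (A i).Nonempty := (mem_supp.1 (hmem i)).1
  let l : (Fin k → ℝ) →ₗ[ℝ] ℝ × ℝ :=
    (Fintype.linearCombination ℝ fun _ => (1 : ℝ)).prod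
      (Fintype.linearCombination ℝ fun i => Real.log (A i).card)
  have key (S : Finset (Fin k)) (hS : 3 ≤ S.card) (hpos : ∀ i ∈ S, 0 ≤ hherm.eigenvalues i) :
      ∃ α' : Finset (Fin q) → ℝ, IsSolution q s α' ∧ supp q α' ⊂ supp q α ∧
        (∀ B : Finset (Fin q), (∀ i, B ≠ A i) → α' B = α B) ∧
        (∀ t : ℝ, t ∈ Set.Icc (0 : ℝ) 1 → Feas q s (fun B => (1 - t) * α B + t * α' B)) ∧
        ((∀ i ∈ S, 0 < hherm.eigenvalues i) → eQ q α < eQ q α') := by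
    obtain ⟨v, hv0, hlv, w, hw0, hwS, hvw⟩ :=
      hherm.exists_ne_zero_dotProduct_mulVec_eq l S hS
    obtain ⟨hl1, hl2⟩ := Prod.ext_iff.1 hlv
    have hterm (i : Fin k) : 0 ≤ hherm.eigenvalues i * w i ^ 2 := by
      by_cases hi : i ∈ S
      · exact mul_nonneg (hpos i hi) (sq_nonneg _)
      · simp [hwS i hi]
    have hext := eQ_extend hinj hA v
    rw [← hMdef, hvw] at hext
    obtain ⟨α', hsol, hsupp, hagree, hseg, hstrict⟩ :=
      hα.exists_shift (x := Function.extend A v 0)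
      (fun B hB => by
        by_cases h : ∃ i, A i = B
        · obtain ⟨i, rfl⟩ := h
          exact hmem i
        · exact absurd (Function.extend_apply' _ _ _ h) hB)
      (fun h => hv0 (funext fun i => by simpa [hinj.extend_apply] using congrFun h (A i)))
      (by simpa [vQ, l, Fintype.linearCombination_apply] using
        (sum_extend_mul hinj hA v fun _ => 1).trans hl1)
      ((sum_extend_mul hinj hA v fun B => Real.log B.card).trans hl2)
      (by rw [hext]; exact mul_nonneg (by norm_num) (sum_nonneg fun i _ => hterm i))
    refine ⟨α', hsol, hsupp, fun B hB => hagree B ?_, hseg, fun h => hstrict ?_⟩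
    · exact Function.extend_apply' _ _ _ fun ⟨i, hi⟩ => hB i hi.symm
    · obtain ⟨i, hi⟩ := Function.ne_iff.1 hw0
      have hiS : i ∈ S := by_contra fun h => hi (hwS i h)
      rw [hext]
      exact mul_pos (by norm_num) (sum_pos' (fun i _ => hterm i)
        ⟨i, mem_univ i, mul_pos (h i hiS) (sq_pos_of_ne_zero hi)⟩)
  refine ⟨?_, fun h => ?_⟩
  · by_contra! h
    obtain ⟨α', hsol, -, -, -, hlt⟩ := key _ h fun i hi => (mem_filter.1 hi).2.le
    exact absurd (hlt fun i hi => (mem_filter.1 hi).2)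
      (not_lt.2 ((hsol.eQ_le hs hsq).trans hα.1.2.2.2))
  · obtain ⟨α', hsol, hsupp, hagree, hseg, -⟩ := key _ h fun i hi => (mem_filter.1 hi).2
    exact ⟨α', hsol, hsupp, hagree, hseg⟩
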